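/- arXiv:1009.3219 — 2 statements merged into one kernel-verified Lean document; each statement's English description precedes it below -/
import Mathlib

section
/- Let P ∈ ℝ[x,y] be a nonzero polynomial of total degree m ≥ 1, with homogeneous decomposition P = Σ_{k=0}^m P_k, and let (a,b) ∈ ℝ² with (a,b) ≠ (0,0). Let s be an integer with 1 ≤ s ≤ m and suppose there exist polynomials Q_m, Q_{m−1}, …, Q_{m−s+1} ∈ ℝ[x,y] satisfying the divisibility chain P_m = (ax+by)^s · Q_m, P_{m−1} = (ax+by)^{s−1} · Q_{m−1}, …, P_{m−s+1} = (ax+by) · Q_{m−s+1}. If the line {(x,y) : ax + by = t} is an asymptote of Z(P), then t is a root of the equation t^s · Q_m(b,−a) + t^{s−1} · Q_{m−1}(b,−a) + ⋯ + t · Q_{m−s+1}(b,−a) + P_{m−s}(b,−a) = 0. -/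
/-- The real zero set of a polynomial `P ∈ ℝ[x,y]`. -/
def Zset (P : MvPolynomial (Fin 2) ℝ) : Set (ℝ × ℝ) :=
  {p : ℝ × ℝ | MvPolynomial.eval ![p.1, p.2] P = 0}

/-- A line `ℓ ⊆ ℝ²` is an asymptote of `Z(P)` if there is a sequence of points of `Z(P)`
whose norms tend to infinity and whose distances to `ℓ` tend to zero. -/
def IsAsymptote (P : MvPolynomial (Fin 2) ℝ) (ℓ : Set (ℝ × ℝ)) : Prop :=
  (∃ a b t : ℝ, (a, b) ≠ (0, 0) ∧ ℓ = {p : ℝ × ℝ | a * p.1 + b * p.2 = t}) ∧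
  ∃ u : ℕ → ℝ × ℝ, (∀ n, u n ∈ Zset P) ∧
    Filter.Tendsto (fun n => ‖u n‖) Filter.atTop Filter.atTop ∧
    Filter.Tendsto (fun n => Metric.infDist (u n) ℓ) Filter.atTop (nhds 0)

open Filter Topology

namespace MvPolynomial

theorem IsHomogeneous.eval_smul {σ R : Type*} [CommSemiring R] {n : ℕ} {F : MvPolynomial σ R}
    (hF : F.IsHomogeneous n) (r : R) (x : σ → R) : eval (r • x) F = r ^ n * eval x F := by
  rw [eval_eq, eval_eq, Finset.mul_sum]
  refine Finset.sum_congr rfl fun d hd => ?_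
  have hdeg : ∑ i ∈ d.support, d i = n := (hF.degree_eq_sum_deg_support hd).symm
  simp only [Pi.smul_apply, smul_eq_mul, mul_pow, Finset.prod_mul_distrib,
    Finset.prod_pow_eq_pow_sum, hdeg]
  ring

/-- If `P` vanishes at `r • w`, then so does the sum of the values of its homogeneous components
at `w`, each weighted by the power of `r` given by its degree minus `m - s`. -/
theorem sum_homogeneousComponent_eval_eq_zero {σ : Type*} {P : MvPolynomial σ ℝ} {m s : ℕ}
    (hdeg : P.totalDegree = m) (hsm : s ≤ m) {r : ℝ} (hr : r ≠ 0) {w : σ → ℝ}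
    (h : eval (r • w) P = 0) :
    (∑ i ∈ Finset.range s, r ^ (s - i) * eval w (homogeneousComponent (m - i) P)) +
      ∑ k ∈ Finset.range (m - s + 1),
        r⁻¹ ^ (m - s - k) * eval w (homogeneousComponent k P) = 0 := by
  have hsum : ∑ k ∈ Finset.range (m + 1), r ^ k * eval w (homogeneousComponent k P) = 0 := by
    rw [← h]
    conv_rhs => rw [← sum_homogeneousComponent P, hdeg, map_sum]
    exact Finset.sum_congr rfl fun k _ =>
      ((homogeneousComponent_isHomogeneous k P).eval_smul r w).symm
  have hsplit : m + 1 = (m - s + 1) + s := by omega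
  rw [hsplit, Finset.sum_range_add, ← Finset.sum_range_reflect _ s] at hsum
  have hpow : r ^ (m - s) ≠ 0 := pow_ne_zero _ hr
  refine (mul_eq_zero.mp ?_).resolve_left hpow
  rw [← hsum, add_comm, mul_add, Finset.mul_sum, Finset.mul_sum]
  congr 1
  · refine Finset.sum_congr rfl fun k hk => ?_
    have hk' : k ≤ m - s := by simpa [Nat.lt_succ_iff] using hk
    rw [← mul_assoc]
    congr 1
    nth_rewrite 1 [← Nat.add_sub_cancel' hk']
    rw [pow_add, mul_assoc, ← mul_pow, mul_inv_cancel₀ hr, one_pow, mul_one]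
  · refine Finset.sum_congr rfl fun i hi => ?_
    have hi' := Finset.mem_range.mp hi
    have hidx : m - s + 1 + (s - 1 - i) = m - i := by omega
    have hidx' : m - s + (s - i) = m - i := by omega
    rw [hidx, ← mul_assoc, ← pow_add, hidx']

end MvPolynomial

theorem tendsto_linearForm_of_tendsto_infDist {a b : ℝ} (hab : (a, b) ≠ ((0 : ℝ), (0 : ℝ)))
    {t : ℝ} {u : ℕ → ℝ × ℝ}
    (hu : Tendsto (fun n => Metric.infDist (u n) {p : ℝ × ℝ | a * p.1 + b * p.2 = t})
      atTop (𝓝 0)) :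
    Tendsto (fun n => a * (u n).1 + b * (u n).2) atTop (𝓝 t) := by
  have hD : a ^ 2 + b ^ 2 ≠ 0 := fun h => hab (by
    ext <;> simp only <;> nlinarith [sq_nonneg a, sq_nonneg b])
  have hne : {p : ℝ × ℝ | a * p.1 + b * p.2 = t}.Nonempty :=
    ⟨(t * a / (a ^ 2 + b ^ 2), t * b / (a ^ 2 + b ^ 2)), by
      simp only [Set.mem_ofPred_eq]; field_simp⟩
  have hC : 0 < |a| + |b| := by
    rcases eq_or_ne a 0 with rfl | ha
    · have hb : b ≠ 0 := by rintro rfl; exact hab rfl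
      positivity
    · positivity
  rw [tendsto_iff_dist_tendsto_zero]
  refine squeeze_zero (fun _ => dist_nonneg) (fun n => ?_)
    (by simpa using hu.const_mul (|a| + |b|))
  rw [← div_le_iff₀' hC, Metric.le_infDist hne]
  rintro y rfl
  rw [div_le_iff₀' hC, Real.dist_eq, Prod.dist_eq]
  calc |a * (u n).1 + b * (u n).2 - (a * y.1 + b * y.2)|
      = |a * ((u n).1 - y.1) + b * ((u n).2 - y.2)| := by ring_nf
    _ ≤ |a| * dist (u n).1 y.1 + |b| * dist (u n).2 y.2 := by
        rw [Real.dist_eq, Real.dist_eq, ← abs_mul, ← abs_mul]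
        exact abs_add_le _ _
    _ ≤ (|a| + |b|) * max (dist (u n).1 y.1) (dist (u n).2 y.2) := by
        rw [add_mul]
        gcongr
        · exact le_max_left _ _
        · exact le_max_right _ _

/-- If a linear form converges along a sequence of points going to infinity, then the
coordinate along the kernel of the form tends to infinity in absolute value. -/
theorem tendsto_abs_kernelCoord {a b : ℝ} (hD : a ^ 2 + b ^ 2 ≠ 0) {t : ℝ} {u : ℕ → ℝ × ℝ}
    (hu : Tendsto (fun n => ‖u n‖) atTop atTop)
    (hv : Tendsto (fun n => a * (u n).1 + b * (u n).2) atTop (𝓝 t)) :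
    Tendsto (fun n => |(b * (u n).1 - a * (u n).2) / (a ^ 2 + b ^ 2)|) atTop atTop := by
  have hC : 0 < |a| + |b| := by
    rcases eq_or_ne a 0 with rfl | ha
    · have hb : b ≠ 0 := by rintro rfl; simp at hD
      positivity
    · positivity
  have hlim : Tendsto (fun n => (‖u n‖ +
      -((|a| + |b|) * |(a * (u n).1 + b * (u n).2) / (a ^ 2 + b ^ 2)|)) / (|a| + |b|))
      atTop atTop :=
    (hu.atTop_add (((hv.div_const _).abs.const_mul _).neg)).atTop_div_const hC
  refine tendsto_atTop_mono (fun n => ?_) hlim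
  set r := (b * (u n).1 - a * (u n).2) / (a ^ 2 + b ^ 2) with hr
  set q := (a * (u n).1 + b * (u n).2) / (a ^ 2 + b ^ 2) with hq
  have h₁ : (u n).1 = b * r + a * q := by rw [hr, hq]; field_simp; ring
  have h₂ : (u n).2 = -a * r + b * q := by rw [hr, hq]; field_simp; ring
  rw [div_le_iff₀ hC, ← sub_eq_add_neg, sub_le_iff_le_add, Prod.norm_def, h₁, h₂]
  have hr0 := abs_nonneg r
  have hq0 := abs_nonneg q
  have ha0 := abs_nonneg a
  have hb0 := abs_nonneg b
  refine max_le ((norm_add_le _ _).trans ?_) ((norm_add_le _ _).trans ?_) <;>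
  · simp only [Real.norm_eq_abs, abs_mul, abs_neg]
    nlinarith [mul_nonneg hr0 ha0, mul_nonneg hr0 hb0, mul_nonneg hq0 ha0, mul_nonneg hq0 hb0]

/-- Nunemacher's theorem (Remark 2.3): if the homogeneous components of `P` satisfy the
divisibility chain `P_{m-i} = (ax+by)^{s-i}·Q_{m-i}` for `0 ≤ i ≤ s-1`, then any asymptote
`{ax + by = t}` of `Z(P)` has `t` a root of
`t^s·Q_m(b,−a) + t^{s-1}·Q_{m-1}(b,−a) + ⋯ + t·Q_{m-s+1}(b,−a) + P_{m-s}(b,−a) = 0`. -/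
theorem asymptote_values_are_roots
    (P : MvPolynomial (Fin 2) ℝ) (m : ℕ)
    (hP : P ≠ 0) (hdeg : P.totalDegree = m) (hm : 1 ≤ m)
    (a b : ℝ) (hab : (a, b) ≠ ((0 : ℝ), (0 : ℝ)))
    (s : ℕ) (hs1 : 1 ≤ s) (hsm : s ≤ m)
    (Q : ℕ → MvPolynomial (Fin 2) ℝ)
    (hchain : ∀ i < s, MvPolynomial.homogeneousComponent (m - i) P =
      (MvPolynomial.C a * MvPolynomial.X 0 + MvPolynomial.C b * MvPolynomial.X 1) ^ (s - i) *
        Q (m - i))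
    (t : ℝ)
    (hasym : IsAsymptote P {p : ℝ × ℝ | a * p.1 + b * p.2 = t}) :
    (∑ i ∈ Finset.range s, t ^ (s - i) * MvPolynomial.eval ![b, -a] (Q (m - i))) +
      MvPolynomial.eval ![b, -a] (MvPolynomial.homogeneousComponent (m - s) P) = 0 := by
  obtain ⟨-, u, huZ, hu, hdist⟩ := hasym
  have hD : a ^ 2 + b ^ 2 ≠ 0 := fun h => hab (by
    ext <;> simp only <;> nlinarith [sq_nonneg a, sq_nonneg b])
  set L : MvPolynomial (Fin 2) ℝ :=
    MvPolynomial.C a * MvPolynomial.X 0 + MvPolynomial.C b * MvPolynomial.X 1 with hL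
  have hLhom : L.IsHomogeneous 1 :=
    (MvPolynomial.isHomogeneous_C_mul_X a 0).add (MvPolynomial.isHomogeneous_C_mul_X b 1)
  have hv := tendsto_linearForm_of_tendsto_infDist hab hdist
  have hrabs := tendsto_abs_kernelCoord hD hu hv
  set v : ℕ → ℝ := fun n => a * (u n).1 + b * (u n).2 with hvdef
  set r : ℕ → ℝ := fun n => (b * (u n).1 - a * (u n).2) / (a ^ 2 + b ^ 2) with hrdef
  have hrne : ∀ᶠ n in atTop, r n ≠ 0 :=
    (hrabs.eventually_gt_atTop 0).mono fun n hn => abs_pos.mp hn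
  have hrinv : Tendsto (fun n => (r n)⁻¹) atTop (𝓝 0) :=
    tendsto_inv₀_cobounded.comp (tendsto_norm_atTop_iff_cobounded.mp hrabs)
  set w : ℕ → Fin 2 → ℝ := fun n =>
    ![b + a * (v n * (r n)⁻¹ / (a ^ 2 + b ^ 2)), -a + b * (v n * (r n)⁻¹ / (a ^ 2 + b ^ 2))]
    with hwdef
  have hq : Tendsto (fun n => v n * (r n)⁻¹ / (a ^ 2 + b ^ 2)) atTop (𝓝 0) := by
    simpa using (hv.mul hrinv).div_const (a ^ 2 + b ^ 2)
  have hw : Tendsto w atTop (𝓝 ![b, -a]) := by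
    rw [tendsto_pi_nhds]
    intro i
    fin_cases i
    · simpa [hwdef] using (hq.const_mul a).const_add b
    · simpa [hwdef] using (hq.const_mul b).const_add (-a)
  have heval (F : MvPolynomial (Fin 2) ℝ) :
      Tendsto (fun n => MvPolynomial.eval (w n) F) atTop (𝓝 (MvPolynomial.eval ![b, -a] F)) :=
    ((MvPolynomial.continuous_eval F).tendsto _).comp hw
  have hlim : Tendsto (fun n =>
      (∑ i ∈ Finset.range s, v n ^ (s - i) * MvPolynomial.eval (w n) (Q (m - i))) +
        ∑ k ∈ Finset.range (m - s + 1), (r n)⁻¹ ^ (m - s - k) *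
          MvPolynomial.eval (w n) (MvPolynomial.homogeneousComponent k P)) atTop
      (𝓝 ((∑ i ∈ Finset.range s, t ^ (s - i) * MvPolynomial.eval ![b, -a] (Q (m - i))) +
        ∑ k ∈ Finset.range (m - s + 1), 0 ^ (m - s - k) *
          MvPolynomial.eval ![b, -a] (MvPolynomial.homogeneousComponent k P))) :=
    (tendsto_finsetSum _ fun i _ => (hv.pow _).mul (heval _)).add
      (tendsto_finsetSum _ fun k _ => (hrinv.pow _).mul (heval _))
  have hlast : ∑ k ∈ Finset.range (m - s + 1), (0 : ℝ) ^ (m - s - k) *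
      MvPolynomial.eval ![b, -a] (MvPolynomial.homogeneousComponent k P) =
      MvPolynomial.eval ![b, -a] (MvPolynomial.homogeneousComponent (m - s) P) := by
    rw [Finset.sum_range_succ, Finset.sum_eq_zero fun k hk => ?_]
    · simp
    · rw [zero_pow (Nat.sub_ne_zero_of_lt (Finset.mem_range.mp hk)), zero_mul]
  rw [hlast] at hlim
  refine tendsto_nhds_unique (hlim.congr' ?_) tendsto_const_nhds
  filter_upwards [hrne] with n hn
  have hrw : r n • w n = ![(u n).1, (u n).2] := by
    have h₁ : r n * (a ^ 2 + b ^ 2) = b * (u n).1 - a * (u n).2 := div_mul_cancel₀ _ hD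
    ext i
    fin_cases i
    · simp only [hwdef, Fin.zero_eta, Pi.smul_apply, Matrix.cons_val_zero, smul_eq_mul]
      field_simp
      simp only [hvdef]
      linear_combination b * h₁
    · simp only [hwdef, Fin.mk_one, Pi.smul_apply, Matrix.cons_val_one,
        Matrix.cons_val_fin_one, smul_eq_mul]
      field_simp
      simp only [hvdef]
      linear_combination -a * h₁
  have hzero : MvPolynomial.eval (r n • w n) P = 0 := by rw [hrw]; exact huZ n
  rw [← MvPolynomial.sum_homogeneousComponent_eval_eq_zero hdeg hsm hn hzero]
  congr 1
  refine Finset.sum_congr rfl fun i hi => ?_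
  have hLv : r n * MvPolynomial.eval (w n) L = v n := by
    rw [← pow_one (r n), ← hLhom.eval_smul, hrw]
    simp [hL, hvdef]
  rw [hchain i (Finset.mem_range.mp hi), map_mul, map_pow, ← mul_assoc, ← mul_pow, hLv]
end

section
/- Let P ∈ ℝ[x,y] be a nonzero polynomial of total degree m ≥ 1, with homogeneous decomposition P = Σ_{k=0}^m P_k, and let (a,b) ∈ ℝ² with (a,b) ≠ (0,0). Suppose (ax+by) is a simple factor of the top form, i.e. P_m = (ax+by)·Q_m with Q_m(b,−a) ≠ 0. Then there is at most one asymptote of Z(P) of the form {ax + by = t}, and if the line {ax + by = t} is an asymptote of Z(P) then t·Q_m(b,−a) + P_{m−1}(b,−a) = 0, i.e. t = −P_{m−1}(b,−a)/Q_m(b,−a). -/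
open Filter Topology

/-- A homogeneous polynomial of degree `n` scales by `r ^ n` along rays. -/
theorem MvPolynomial.IsHomogeneous.eval_smul_point {σ R : Type*} [CommSemiring R]
    {p : MvPolynomial σ R} {n : ℕ} (hp : p.IsHomogeneous n) (r : R) (v : σ → R) :
    eval (r • v) p = r ^ n * eval v p := by
  rw [eval_eq, eval_eq, Finset.mul_sum]
  refine Finset.sum_congr rfl fun d hd => ?_
  have hdeg : ∑ i ∈ d.support, d i = n := by
    rw [← Finsupp.degree_apply, Finsupp.degree_eq_weight_one]
    exact hp (mem_support_iff.mp hd)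
  simp only [Pi.smul_apply, smul_eq_mul, mul_pow, Finset.prod_mul_distrib, Finset.prod_pow_eq_pow_sum,
    hdeg]
  ring

/-- If a polynomial of degree at most `n + 1` vanishes at `r_k • w_k` with `r_k → ∞`, `w_k → v`,
and `r_k` times the value of its top form at `w_k` tends to `T`, then `T` cancels the value at `v`
of its form of degree `n`. -/
theorem add_eval_homogeneousComponent_eq_zero {σ : Type*} {P : MvPolynomial σ ℝ} {n : ℕ}
    (hdeg : P.totalDegree = n + 1) {r : ℕ → ℝ} {w : ℕ → σ → ℝ} {v : σ → ℝ} {T : ℝ}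
    (hzero : ∀ k, MvPolynomial.eval (r k • w k) P = 0)
    (hr : Tendsto (fun k => |r k|) atTop atTop) (hw : Tendsto w atTop (𝓝 v))
    (hT : Tendsto (fun k => r k * MvPolynomial.eval (w k)
      (MvPolynomial.homogeneousComponent (n + 1) P)) atTop (𝓝 T)) :
    T + MvPolynomial.eval v (MvPolynomial.homogeneousComponent n P) = 0 := by
  have hinv : Tendsto (fun k => (r k)⁻¹) atTop (𝓝 0) := by
    rw [tendsto_zero_iff_abs_tendsto_zero]
    simpa [Function.comp_def, abs_inv] using tendsto_inv_atTop_zero.comp hr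
  have heval (j : ℕ) : Tendsto (fun k => MvPolynomial.eval (w k)
      (MvPolynomial.homogeneousComponent j P)) atTop
      (𝓝 (MvPolynomial.eval v (MvPolynomial.homogeneousComponent j P))) :=
    ((MvPolynomial.continuous_eval _).tendsto v).comp hw
  have hlow : Tendsto (fun k => ∑ j ∈ Finset.range n, (r k)⁻¹ ^ (n - j) *
      MvPolynomial.eval (w k) (MvPolynomial.homogeneousComponent j P)) atTop (𝓝 0) := by
    rw [← Finset.sum_const_zero (s := Finset.range n)]
    refine tendsto_finsetSum _ fun j hj => ?_
    have hpow := (hinv.pow (n - j)).mul (heval j)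
    rwa [zero_pow (Nat.sub_ne_zero_of_lt (Finset.mem_range.mp hj)), zero_mul] at hpow
  have hsum := (hlow.add (heval n)).add hT
  have hev : (fun _ => (0 : ℝ)) =ᶠ[atTop] fun k => ∑ j ∈ Finset.range n, (r k)⁻¹ ^ (n - j) *
      MvPolynomial.eval (w k) (MvPolynomial.homogeneousComponent j P) +
      MvPolynomial.eval (w k) (MvPolynomial.homogeneousComponent n P) +
      r k * MvPolynomial.eval (w k) (MvPolynomial.homogeneousComponent (n + 1) P) := by
    filter_upwards [hr.eventually_gt_atTop 0] with k hk
    have hk0 : r k ≠ 0 := abs_pos.mp hk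
    have h := hzero k
    rw [← MvPolynomial.sum_homogeneousComponent P, hdeg, map_sum] at h
    simp only [(MvPolynomial.homogeneousComponent_isHomogeneous _ P).eval_smul_point] at h
    rw [Finset.sum_range_succ, Finset.sum_range_succ] at h
    refine (mul_left_cancel₀ (pow_ne_zero n hk0) ?_)
    rw [mul_zero, ← h, mul_add, mul_add, Finset.mul_sum, pow_succ, mul_assoc]
    congr 2
    refine Finset.sum_congr rfl fun j hj => ?_
    rw [← mul_assoc, inv_pow, ← pow_sub_mul_pow (r k) (Finset.mem_range.mp hj).le]
    field_simp
  have := tendsto_nhds_unique (tendsto_const_nhds.congr' hev) hsum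
  linarith

theorem abs_add_abs_pos_of_sq_add_sq_pos {a b : ℝ} (hab : 0 < a ^ 2 + b ^ 2) :
    0 < |a| + |b| := by
  by_contra! h
  have ha : a = 0 := abs_nonpos_iff.mp (by linarith [abs_nonneg b])
  have hb : b = 0 := abs_nonpos_iff.mp (by linarith [abs_nonneg a])
  simp [ha, hb] at hab

/-- The deviation of `ax + by` from `t` is controlled by the distance to the line
`{ax + by = t}`. -/
theorem abs_sub_le_mul_infDist_line {a b : ℝ} (hab : 0 < a ^ 2 + b ^ 2) (t : ℝ) (p : ℝ × ℝ) :
    |a * p.1 + b * p.2 - t| ≤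
      (|a| + |b|) * Metric.infDist p {q : ℝ × ℝ | a * q.1 + b * q.2 = t} := by
  have hK := abs_add_abs_pos_of_sq_add_sq_pos hab
  have hne : {q : ℝ × ℝ | a * q.1 + b * q.2 = t}.Nonempty :=
    ⟨(t * a / (a ^ 2 + b ^ 2), t * b / (a ^ 2 + b ^ 2)), by
      simp only [Set.mem_ofPred_eq]; field_simp⟩
  rw [← div_le_iff₀' hK, Metric.le_infDist hne]
  intro q hq
  rw [div_le_iff₀' hK, ← Set.mem_ofPred_eq.mp hq]
  have h1 : |p.1 - q.1| ≤ dist p q := by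
    rw [← Real.dist_eq]; exact le_max_left _ _
  have h2 : |p.2 - q.2| ≤ dist p q := by
    rw [← Real.dist_eq]; exact le_max_right _ _
  calc |a * p.1 + b * p.2 - (a * q.1 + b * q.2)|
      = |a * (p.1 - q.1) + b * (p.2 - q.2)| := by congr 1; ring
    _ ≤ |a| * |p.1 - q.1| + |b| * |p.2 - q.2| := by
      simpa only [abs_mul] using abs_add_le (a * (p.1 - q.1)) (b * (p.2 - q.2))
    _ ≤ (|a| + |b|) * dist p q := by
      rw [add_mul]; gcongr

/-- The norm of a point is controlled by its coordinates in the orthogonal basis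
`(b, -a), (a, b)`. -/
theorem norm_le_of_orthogonal_coordinates {a b : ℝ} (hab : 0 < a ^ 2 + b ^ 2) (p : ℝ × ℝ) :
    ‖p‖ ≤ (|a| + |b|) * |(b * p.1 - a * p.2) / (a ^ 2 + b ^ 2)| +
      (|a| + |b|) * |(a * p.1 + b * p.2) / (a ^ 2 + b ^ 2)| := by
  set r := (b * p.1 - a * p.2) / (a ^ 2 + b ^ 2) with hr
  set s := (a * p.1 + b * p.2) / (a ^ 2 + b ^ 2) with hs
  have h1 : p.1 = b * r + a * s := by rw [hr, hs]; field_simp; ring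
  have h2 : p.2 = -a * r + b * s := by rw [hr, hs]; field_simp; ring
  have hle (c d : ℝ) (hc : |c| ≤ |a| + |b|) (hd : |d| ≤ |a| + |b|) :
      |c * r + d * s| ≤ (|a| + |b|) * |r| + (|a| + |b|) * |s| := by
    refine (abs_add_le _ _).trans ?_
    rw [abs_mul, abs_mul]
    gcongr
  rw [Prod.norm_def, Real.norm_eq_abs, Real.norm_eq_abs, h1, h2]
  refine max_le (hle b a ?_ ?_) (hle (-a) b ?_ ?_) <;>
    simp

/-- An asymptote `{ax + by = t}` of `Z(P)` whose linear form divides the top form of `P`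
satisfies the equation obtained from the two forms of highest degree. -/
theorem IsAsymptote.mul_eval_add_eval_eq_zero {P : MvPolynomial (Fin 2) ℝ} {n : ℕ}
    (hdeg : P.totalDegree = n + 1) {a b : ℝ} (hab : (a, b) ≠ ((0 : ℝ), (0 : ℝ)))
    {Q : MvPolynomial (Fin 2) ℝ}
    (hfac : MvPolynomial.homogeneousComponent (n + 1) P =
      (MvPolynomial.C a * MvPolynomial.X 0 + MvPolynomial.C b * MvPolynomial.X 1) * Q)
    {t : ℝ} (h : IsAsymptote P {p : ℝ × ℝ | a * p.1 + b * p.2 = t}) :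
    t * MvPolynomial.eval ![b, -a] Q +
      MvPolynomial.eval ![b, -a] (MvPolynomial.homogeneousComponent n P) = 0 := by
  have hc : 0 < a ^ 2 + b ^ 2 := by
    refine lt_of_le_of_ne (by positivity) fun h0 => hab ?_
    have ha : a = 0 := by nlinarith [sq_nonneg a, sq_nonneg b]
    have hb : b = 0 := by nlinarith [sq_nonneg a, sq_nonneg b]
    rw [ha, hb]
  obtain ⟨-, u, hu, hnorm, hdist⟩ := h
  have hs : Tendsto (fun k => a * (u k).1 + b * (u k).2) atTop (𝓝 t) := by
    rw [tendsto_iff_dist_tendsto_zero]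
    refine squeeze_zero (fun _ => dist_nonneg)
      (fun k => abs_sub_le_mul_infDist_line hc t (u k)) ?_
    simpa using hdist.const_mul (|a| + |b|)
  set r : ℕ → ℝ := fun k => (b * (u k).1 - a * (u k).2) / (a ^ 2 + b ^ 2) with hrdef
  have hsc := hs.div_const (a ^ 2 + b ^ 2)
  have hr : Tendsto (fun k => |r k|) atTop atTop := by
    have hlow := hnorm.atTop_add ((hsc.abs.const_mul (|a| + |b|)).neg)
    have hKr : Tendsto (fun k => (|a| + |b|) * |r k|) atTop atTop :=
      tendsto_atTop_mono (fun k => by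
        linarith [norm_le_of_orthogonal_coordinates hc (u k)]) hlow
    exact (tendsto_const_mul_atTop_of_pos (abs_add_abs_pos_of_sq_add_sq_pos hc)).mp hKr
  have hinv : Tendsto (fun k => (r k)⁻¹) atTop (𝓝 0) := by
    rw [tendsto_zero_iff_abs_tendsto_zero]
    simpa [Function.comp_def, abs_inv] using tendsto_inv_atTop_zero.comp hr
  obtain ⟨N, hN⟩ := (hr.eventually_gt_atTop 0).exists_forall_of_atTop
  have hr0 (k : ℕ) : r (k + N) ≠ 0 := abs_pos.mp (hN _ (Nat.le_add_left _ _))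
  set w : ℕ → Fin 2 → ℝ := fun k => (r k)⁻¹ • ![(u k).1, (u k).2] with hwdef
  have hrw (k : ℕ) : r (k + N) • w (k + N) = ![(u (k + N)).1, (u (k + N)).2] :=
    smul_inv_smul₀ (hr0 k) _
  have hw : Tendsto (fun k => w (k + N)) atTop (𝓝 ![b, -a]) := by
    have hq := (hinv.mul hsc).comp (tendsto_add_atTop_nat N)
    have hcoord (k : ℕ) : w (k + N) = ![b, -a] + ((r (k + N))⁻¹ *
        ((a * (u (k + N)).1 + b * (u (k + N)).2) / (a ^ 2 + b ^ 2))) • ![a, b] := by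
      rw [← sub_eq_zero, ← smul_eq_zero_iff_right (hr0 k), smul_sub, hrw, smul_add, smul_smul,
        mul_inv_cancel_left₀ (hr0 k)]
      ext i
      fin_cases i <;> simp [hrdef] <;> field_simp <;> ring
    simp only [hcoord]
    simpa [Function.comp_def] using (hq.smul_const ![a, b]).const_add ![b, -a]
  refine add_eval_homogeneousComponent_eq_zero hdeg (r := fun k => r (k + N))
    (w := fun k => w (k + N)) (fun k => ?_) (hr.comp (tendsto_add_atTop_nat N)) hw ?_
  · rw [hrw]
    exact hu _
  · have hQ := ((MvPolynomial.continuous_eval Q).tendsto ![b, -a]).comp hw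
    refine ((hs.comp (tendsto_add_atTop_nat N)).mul hQ).congr fun k => ?_
    have h0 : r (k + N) * w (k + N) 0 = (u (k + N)).1 := congrFun (hrw k) 0
    have h1 : r (k + N) * w (k + N) 1 = (u (k + N)).2 := congrFun (hrw k) 1
    simp only [hfac, Function.comp_apply, map_mul, map_add, MvPolynomial.eval_C,
      MvPolynomial.eval_X, ← h0, ← h1]
    ring

/-- Nunemacher's corollary (Remark 2.3): if `aX + bY` is a simple factor of the top form,
`P_m = (aX+bY)·Q_m` with `Q_m(b,−a) ≠ 0`, then there is at most one asymptote of `Z(P)` of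
the form `{ax + by = t}`, and such an asymptote satisfies
`t·Q_m(b,−a) + P_{m−1}(b,−a) = 0`. -/
theorem simple_factor_gives_single_asymptote
    (P : MvPolynomial (Fin 2) ℝ) (m : ℕ)
    (hP : P ≠ 0) (hdeg : P.totalDegree = m) (hm : 1 ≤ m)
    (a b : ℝ) (hab : (a, b) ≠ ((0 : ℝ), (0 : ℝ)))
    (Qm : MvPolynomial (Fin 2) ℝ)
    (hfac : MvPolynomial.homogeneousComponent m P =
      (MvPolynomial.C a * MvPolynomial.X 0 + MvPolynomial.C b * MvPolynomial.X 1) * Qm)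
    (hsimple : MvPolynomial.eval ![b, -a] Qm ≠ 0) :
    (∀ t t' : ℝ, IsAsymptote P {p : ℝ × ℝ | a * p.1 + b * p.2 = t} →
      IsAsymptote P {p : ℝ × ℝ | a * p.1 + b * p.2 = t'} → t = t') ∧
    (∀ t : ℝ, IsAsymptote P {p : ℝ × ℝ | a * p.1 + b * p.2 = t} →
      t * MvPolynomial.eval ![b, -a] Qm +
        MvPolynomial.eval ![b, -a] (MvPolynomial.homogeneousComponent (m - 1) P) = 0) := by
  obtain ⟨n, rfl⟩ := Nat.exists_eq_add_of_le' hm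
  have key (t : ℝ) (h : IsAsymptote P {p : ℝ × ℝ | a * p.1 + b * p.2 = t}) :=
    h.mul_eval_add_eval_eq_zero hdeg hab hfac
  refine ⟨fun t t' ht ht' => mul_right_cancel₀ hsimple ?_, key⟩
  linarith [key t ht, key t' ht']
end
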